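/- arXiv:2509.13748 — 2 statements merged into one kernel-verified Lean document; each statement's English description precedes it below -/
import Mathlib

section
/- If (ξ, ζ) ∈ D^{J+K} is continuous, then the unique solution y ∈ D^K of equation (A.1) is continuous; moreover, for each j ∈ [J] the functions u_j(t) := μ_j^{-1} ψ( ξ_j + Σ_{l=1}^K q_{lj} η_l ∫_0^· y_l(s) ds )(t) and x_j(t) := φ( ξ_j + Σ_{l=1}^K q_{lj} η_l ∫_0^· y_l(s) ds )(t) are continuous on [0,∞). -/
open MeasureTheory Set Filter

/-- One-sided reflection map: `psi x t = sup_{s ∈ [0,t]} max (-x s) 0`. -/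
noncomputable def psi (x : ℝ → ℝ) (t : ℝ) : ℝ :=
  sSup ((fun s => max (-x s) 0) '' Set.Icc 0 t)

/-- `phi x t = x t + psi x t`. -/
noncomputable def phi (x : ℝ → ℝ) (t : ℝ) : ℝ := x t + psi x t

/-- Càdlàg on `[0,∞)`: right continuous on `[0,∞)`, left limits on `(0,∞)`. -/
def Cadlag (x : ℝ → ℝ) : Prop :=
  (∀ t : ℝ, 0 ≤ t → ContinuousWithinAt x (Set.Ici t) t) ∧
  (∀ t : ℝ, 0 < t → ∃ L : ℝ, Filter.Tendsto x (nhdsWithin t (Set.Iio t)) (nhds L))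

/-- Càdlàg on `[0,T]`: right continuous on `[0,T)`, left limits on `(0,T]`. -/
def CadlagOn (x : ℝ → ℝ) (T : ℝ) : Prop :=
  (∀ t : ℝ, 0 ≤ t → t < T → ContinuousWithinAt x (Set.Ici t) t) ∧
  (∀ t : ℝ, 0 < t → t ≤ T → ∃ L : ℝ, Filter.Tendsto x (nhdsWithin t (Set.Iio t)) (nhds L))

/-- Sup norm of `x` on `[0,T]`. -/
noncomputable def supNorm (x : ℝ → ℝ) (T : ℝ) : ℝ :=
  sSup ((fun t => |x t|) '' Set.Icc 0 T)

/-- `y` is a càdlàg solution of equation (A.1) on `[0,∞)` for input `(ξ, ζ)`. -/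
def IsSolA1 {J K : ℕ} (η : Fin K → ℝ) (p : Fin J → Fin K → ℝ) (q : Fin K → Fin J → ℝ)
    (ξ : Fin J → ℝ → ℝ) (ζ : Fin K → ℝ → ℝ) (y : Fin K → ℝ → ℝ) : Prop :=
  (∀ k, Cadlag (y k)) ∧
  ∀ k, ∀ t : ℝ, 0 ≤ t →
    y k t = ζ k t - η k * (∫ s in (0:ℝ)..t, y k s)
      - ∑ j, p j k *
          psi (fun r => ξ j r + ∑ l, q l j * η l * (∫ s in (0:ℝ)..r, y l s)) t

/-- A right-continuous real function is Borel measurable. -/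
theorem measurable_of_continuousWithinAt_Ici {g : ℝ → ℝ}
    (hg : ∀ t, ContinuousWithinAt g (Set.Ici t) t) : Measurable g := by
  have hmeas : ∀ n : ℕ,
      Measurable fun t : ℝ => g (((⌊((n : ℝ) + 1) * t⌋ : ℝ) + 1) / ((n : ℝ) + 1)) := fun n =>
    (measurable_from_top (f := fun m : ℤ => g (((m : ℝ) + 1) / ((n : ℝ) + 1)))).comp
      (Int.measurable_floor.comp (measurable_const_mul _))
  refine measurable_of_tendsto_metrizable hmeas (tendsto_pi_nhds.2 fun t => ?_)
  have hlower : ∀ n : ℕ, t ≤ ((⌊((n : ℝ) + 1) * t⌋ : ℝ) + 1) / ((n : ℝ) + 1) := fun n => by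
    rw [le_div_iff₀ (by positivity)]
    linarith [Int.lt_floor_add_one (((n : ℝ) + 1) * t)]
  have hupper : ∀ n : ℕ,
      ((⌊((n : ℝ) + 1) * t⌋ : ℝ) + 1) / ((n : ℝ) + 1) ≤ t + 1 / ((n : ℝ) + 1) := fun n => by
    have hn : (0 : ℝ) < (n : ℝ) + 1 := by positivity
    have hmul : (t + 1 / ((n : ℝ) + 1)) * ((n : ℝ) + 1) = ((n : ℝ) + 1) * t + 1 := by field_simp
    rw [div_le_iff₀ hn, hmul]
    linarith [Int.floor_le (((n : ℝ) + 1) * t)]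
  have hlim : Tendsto (fun n : ℕ => t + 1 / ((n : ℝ) + 1)) atTop (nhds t) := by
    simpa using tendsto_one_div_add_atTop_nhds_zero_nat.const_add t
  refine (hg t).tendsto.comp (tendsto_nhdsWithin_iff.2 ⟨?_, Eventually.of_forall hlower⟩)
  exact tendsto_of_tendsto_of_tendsto_of_le_of_le tendsto_const_nhds hlim hlower hupper

/-- Càdlàg functions are locally integrable on `[0,∞)`. -/
theorem Cadlag.locallyIntegrableOn {x : ℝ → ℝ} (hx : Cadlag x) :
    LocallyIntegrableOn x (Set.Ici 0) := by
  have hmeas : Measurable fun t => x (max t 0) := by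
    refine measurable_of_continuousWithinAt_Ici fun t => ?_
    exact (hx.1 (max t 0) (le_max_right _ _)).comp (f := fun s => max s 0)
      (continuous_id.max continuous_const).continuousWithinAt fun s hs =>
        Set.mem_Ici.2 (max_le_max_right 0 (Set.mem_Ici.1 hs))
  have hsm : ∀ t : ℝ, ∀ s : Set ℝ, s ⊆ Set.Ici 0 → MeasurableSet s →
      StronglyMeasurableAtFilter x (nhdsWithin t s) := fun t s hs hs' =>
    ⟨s, self_mem_nhdsWithin, hmeas.aestronglyMeasurable.congr <|
      (ae_restrict_iff' hs').2 <| Eventually.of_forall fun r hr => by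
        simp only [max_eq_left (Set.mem_Ici.1 (hs hr))]⟩
  intro t ht
  have ht0 : (0 : ℝ) ≤ t := ht
  have hright : IntegrableAtFilter x (nhdsWithin t (Set.Ici t)) :=
    (volume.finiteAt_nhdsWithin t _).integrableAtFilter_of_tendsto
      (hsm t _ (Set.Ici_subset_Ici.2 ht0) measurableSet_Ici) (hx.1 t ht0).tendsto
  rcases ht0.eq_or_lt with rfl | hpos
  · exact hright
  obtain ⟨L, hL⟩ := hx.2 t hpos
  have := measurableSet_Ico.nhdsWithin_isMeasurablyGenerated t (s := Set.Ico 0 t)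
  have hleft : IntegrableAtFilter x (nhdsWithin t (Set.Ico 0 t)) :=
    (volume.finiteAt_nhdsWithin t _).integrableAtFilter_of_tendsto
      (hsm t _ Set.Ico_subset_Ici_self measurableSet_Ico)
      (hL.mono_left (nhdsWithin_mono t Set.Ico_subset_Iio_self))
  have hboth := IntegrableAtFilter.sup_iff.2 ⟨hleft, hright⟩
  rwa [← nhdsWithin_union, Set.Ico_union_Ici_eq_Ici ht0] at hboth

/-- The primitive of a càdlàg function is continuous on `[0,∞)`. -/
theorem Cadlag.continuousOn_primitive {x : ℝ → ℝ} (hx : Cadlag x) :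
    ContinuousOn (fun t => ∫ s in (0:ℝ)..t, x s) (Set.Ici 0) := by
  intro t ht
  have ht0 : (0 : ℝ) ≤ t := ht
  have hint : IntegrableOn x (Set.uIcc 0 (t + 1)) := by
    rw [Set.uIcc_of_le (by linarith)]
    exact hx.locallyIntegrableOn.integrableOn_compact_subset Set.Icc_subset_Ici_self isCompact_Icc
  have hcont := intervalIntegral.continuousOn_primitive_interval hint
  rw [Set.uIcc_of_le (by linarith)] at hcont
  refine (hcont t ⟨ht0, by linarith⟩).mono_of_mem_nhdsWithin ?_
  filter_upwards [self_mem_nhdsWithin, nhdsWithin_le_nhds (gt_mem_nhds (lt_add_one t))]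
    with s hs hst using ⟨hs, hst.le⟩

/-- The one-sided reflection map preserves continuity on `[0,∞)`. -/
theorem ContinuousOn.psi {x : ℝ → ℝ} (hx : ContinuousOn x (Set.Ici 0)) :
    ContinuousOn (psi x) (Set.Ici 0) := by
  have hext : Continuous fun t => x (max t 0) :=
    hx.comp_continuous (continuous_id.max continuous_const) fun t => le_max_right t 0
  have hsup : Continuous fun t : ℝ =>
      sSup ((fun u : ℝ => max (-x (max (t * u) 0)) 0) '' Set.Icc 0 1) :=
    isCompact_Icc.continuous_sSup
      ((hext.comp (continuous_fst.mul continuous_snd)).neg.max continuous_const)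
  refine hsup.continuousOn.congr fun t ht => ?_
  have ht0 : (0 : ℝ) ≤ t := ht
  have himage : Set.Icc 0 t = (fun u => t * u) '' Set.Icc 0 1 := by
    rw [Set.image_mul_left_Icc ht0 zero_le_one, mul_zero, mul_one]
  rw [_root_.psi, himage, Set.image_image]
  congr 1
  refine Set.image_congr fun u hu => ?_
  rw [max_eq_left (mul_nonneg ht0 hu.1)]

/-- Proposition 4.4 (continuity preservation): if the input `(ξ, ζ)` is continuous, then
the unique solution `y` of (A.1) is continuous on `[0,∞)`, and so are the functions
`u_j = μ_j⁻¹ ψ(ξ_j + Σ_l q_{lj} η_l ∫_0^· y_l)` and `x_j = φ(ξ_j + Σ_l q_{lj} η_l ∫_0^· y_l)`. -/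
theorem stmt4
    (J K : ℕ) (hJ : 0 < J) (hK : 0 < K)
    (μ : Fin J → ℝ) (hμ : ∀ j, 0 < μ j)
    (η : Fin K → ℝ) (hη : ∀ k, 0 < η k)
    (p : Fin J → Fin K → ℝ) (hp : ∀ j k, 0 ≤ p j k) (hprow : ∀ j, ∑ k, p j k = 1)
    (q : Fin K → Fin J → ℝ) (hq : ∀ k j, 0 ≤ q k j) (hqrow : ∀ k, ∑ j, q k j = 1)
    (ξ : Fin J → ℝ → ℝ) (hξ : ∀ j, Cadlag (ξ j)) (hξc : ∀ j, ContinuousOn (ξ j) (Set.Ici 0))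
    (ζ : Fin K → ℝ → ℝ) (hζ : ∀ k, Cadlag (ζ k)) (hζc : ∀ k, ContinuousOn (ζ k) (Set.Ici 0))
    (y : Fin K → ℝ → ℝ) (hy : IsSolA1 η p q ξ ζ y) :
    (∀ k, ContinuousOn (y k) (Set.Ici 0)) ∧
    (∀ j, ContinuousOn
      (fun t => (μ j)⁻¹ *
        psi (fun r => ξ j r + ∑ l, q l j * η l * (∫ s in (0:ℝ)..r, y l s)) t)
      (Set.Ici 0)) ∧
    (∀ j, ContinuousOn
      (fun t => phi (fun r => ξ j r + ∑ l, q l j * η l * (∫ s in (0:ℝ)..r, y l s)) t)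
      (Set.Ici 0)) := by
  have hfree : ∀ j, ContinuousOn
      (fun r => ξ j r + ∑ l, q l j * η l * (∫ s in (0:ℝ)..r, y l s)) (Set.Ici 0) := fun j =>
    (hξc j).add (continuousOn_finsetSum _ fun l _ =>
      continuousOn_const.mul (hy.1 l).continuousOn_primitive)
  refine ⟨fun k => ?_, fun j => continuousOn_const.mul (hfree j).psi,
    fun j => (hfree j).add (hfree j).psi⟩
  refine (((hζc k).sub (continuousOn_const.mul (hy.1 k).continuousOn_primitive)).sub
    (continuousOn_finsetSum _ fun j _ => continuousOn_const.mul (hfree j).psi)).congr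
    fun t ht => hy.2 k t ht
end

section
/- Fix (ξ, ζ) ∈ D^{J+K}, T > 0, and δ ∈ (0, T) with 2δηJK < 1. Let y^0 ≡ 0 and, for n ≥ 1 and k ∈ [K], y_k^n := ζ_k − η_k ∫_0^· y_k^{n−1}(s) ds − Σ_{j=1}^J p_{jk} ψ( ξ_j + Σ_{l=1}^K q_{lj} η_l ∫_0^· y_l^{n−1}(s) ds ), and set C_t := max_{k∈[K]} ‖ζ_k‖_t + Σ_{j=1}^J ‖ψ(ξ_j)‖_t for t > 0. Then for every m, n ∈ ℕ with m, n ≥ 1 and every k ∈ [K], ‖y_k^n − y_k^{n−1}‖_{mδ} ≤ m² n^m (2δηJK)^{n−1} C_{mδ}. -/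
open MeasureTheory Set Filter

/-- Local boundedness on `[0,∞)`. -/
def LocallyBddOnNonneg (x : ℝ → ℝ) : Prop :=
  ∀ T : ℝ, ∃ B : ℝ, ∀ t ∈ Icc 0 T, |x t| ≤ B

theorem LocallyBddOnNonneg.add {x y : ℝ → ℝ} (hx : LocallyBddOnNonneg x)
    (hy : LocallyBddOnNonneg y) : LocallyBddOnNonneg (fun t => x t + y t) := by
  intro T
  obtain ⟨A, hA⟩ := hx T
  obtain ⟨B, hB⟩ := hy T
  exact ⟨A + B, fun t ht => (abs_add_le _ _).trans (add_le_add (hA t ht) (hB t ht))⟩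

theorem LocallyBddOnNonneg.const_mul {x : ℝ → ℝ} (c : ℝ) (hx : LocallyBddOnNonneg x) :
    LocallyBddOnNonneg (fun t => c * x t) := by
  intro T
  obtain ⟨A, hA⟩ := hx T
  refine ⟨|c| * A, fun t ht => ?_⟩
  rw [abs_mul]
  exact mul_le_mul_of_nonneg_left (hA t ht) (abs_nonneg c)

theorem LocallyBddOnNonneg.sum {ι : Type*} (s : Finset ι) {x : ι → ℝ → ℝ}
    (hx : ∀ i, LocallyBddOnNonneg (x i)) : LocallyBddOnNonneg (fun t => ∑ i ∈ s, x i t) := by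
  intro T
  choose B hB using fun i => hx i T
  exact ⟨∑ i ∈ s, B i, fun t ht => (Finset.abs_sum_le_sum_abs _ _).trans
    (Finset.sum_le_sum fun i _ => hB i t ht)⟩

theorem Cadlag.locallyBddOnNonneg {x : ℝ → ℝ} (hx : Cadlag x) : LocallyBddOnNonneg x := by
  intro T
  refine (isCompact_Icc (a := (0 : ℝ)) (b := T)).induction_on
    (p := fun s => ∃ B : ℝ, ∀ t ∈ s, |x t| ≤ B) ⟨0, by simp⟩ ?_ ?_ ?_
  · rintro s t hst ⟨B, hB⟩
    exact ⟨B, fun r hr => hB r (hst hr)⟩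
  · rintro s t ⟨A, hA⟩ ⟨B, hB⟩
    refine ⟨max A B, fun r hr => ?_⟩
    rcases hr with hr | hr
    · exact (hA r hr).trans (le_max_left _ _)
    · exact (hB r hr).trans (le_max_right _ _)
  · intro t ht
    have hbdd : ∀ {l : Filter ℝ} {L : ℝ}, Tendsto x l (nhds L) → ∀ᶠ r in l, |x r| ≤ |L| + 1 :=
      fun h => h.abs.eventually_le_const (lt_add_one _)
    have hright : ∀ᶠ r in nhdsWithin t (Ici t), |x r| ≤ |x t| + 1 := hbdd (hx.1 t ht.1)
    have hleft : ∃ B : ℝ, ∀ᶠ r in nhdsWithin t (Iio t), 0 ≤ r → |x r| ≤ B := by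
      rcases ht.1.eq_or_lt with h0 | hpos
      · refine ⟨0, ?_⟩
        filter_upwards [self_mem_nhdsWithin] with r hr h
        exact absurd (h0 ▸ h : t ≤ r) (not_le.2 hr)
      · obtain ⟨L, hL⟩ := hx.2 t hpos
        exact ⟨|L| + 1, (hbdd hL).mono fun r hr _ => hr⟩
    obtain ⟨B, hB⟩ := hleft
    refine ⟨{r | 0 ≤ r → |x r| ≤ max B (|x t| + 1)} ∩ Icc 0 T, ?_, max B (|x t| + 1),
      fun r hr => hr.1 hr.2.1⟩
    refine inter_mem (mem_nhdsWithin_of_mem_nhds ?_) self_mem_nhdsWithin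
    rw [← nhdsLT_sup_nhdsGE t]
    refine mem_sup.2 ⟨?_, ?_⟩
    · filter_upwards [hB] with r hr h
      exact (hr h).trans (le_max_left _ _)
    · filter_upwards [hright] with r hr _
      exact hr.trans (le_max_right _ _)

/-- A function that is right continuous on `[0,∞)` is measurable there: it is the limit of its
values at the next point of the grid `ℤ / (n + 1)`. -/
theorem Cadlag.measurable_indicator {x : ℝ → ℝ} (hx : Cadlag x) :
    Measurable ((Ici (0 : ℝ)).indicator x) := by
  have hgrid : ∀ n : ℕ, Measurable fun t : ℝ => (⌊((n : ℝ) + 1) * t⌋ : ℤ) := fun n =>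
    Int.measurable_floor.comp (measurable_const.mul measurable_id)
  refine measurable_of_tendsto_metrizable
    (f := fun (n : ℕ) => (Ici (0 : ℝ)).indicator
      fun t => x (((⌊((n : ℝ) + 1) * t⌋ : ℝ) + 1) / ((n : ℝ) + 1))) (fun n => ?_) ?_
  · exact ((measurable_from_top (f := fun z : ℤ => x (((z : ℝ) + 1) / ((n : ℝ) + 1)))).comp
      (hgrid n)).indicator measurableSet_Ici
  · refine tendsto_pi_nhds.2 fun t => ?_
    by_cases ht : t ∈ Ici (0 : ℝ)
    · simp only [indicator_of_mem ht]
      refine (hx.1 t ht).tendsto.comp (tendsto_nhdsWithin_iff.2 ⟨?_, .of_forall fun n => ?_⟩)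
      · have hlim : Tendsto (fun n : ℕ => t + 1 / ((n : ℝ) + 1)) atTop (nhds t) := by
          simpa using tendsto_const_nhds.add (tendsto_one_div_add_atTop_nhds_zero_nat (𝕜 := ℝ))
        refine tendsto_of_tendsto_of_tendsto_of_le_of_le tendsto_const_nhds hlim
          (fun n => ?_) (fun n => ?_)
        · have hn : (0 : ℝ) < (n : ℝ) + 1 := by positivity
          simp only
          rw [le_div_iff₀ hn, mul_comm]
          exact (Int.lt_floor_add_one _).le
        · have hn : (0 : ℝ) < (n : ℝ) + 1 := by positivity
          simp only
          rw [div_le_iff₀ hn, add_mul t, one_div_mul_cancel hn.ne', mul_comm t]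
          gcongr
          exact Int.floor_le _
      · have hn : (0 : ℝ) < (n : ℝ) + 1 := by positivity
        rw [mem_Ici, le_div_iff₀ hn, mul_comm]
        exact (Int.lt_floor_add_one _).le
    · simp only [indicator_of_notMem ht]
      exact tendsto_const_nhds

theorem Cadlag.intervalIntegrable {x : ℝ → ℝ} (hx : Cadlag x) {T : ℝ} (hT : 0 ≤ T) :
    IntervalIntegrable x volume 0 T := by
  obtain ⟨B, hB⟩ := hx.locallyBddOnNonneg T
  rw [intervalIntegrable_iff_integrableOn_Icc_of_le hT]
  have hmeas : AEStronglyMeasurable x (volume.restrict (Icc 0 T)) := by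
    refine hx.measurable_indicator.aestronglyMeasurable.congr ?_
    filter_upwards [ae_restrict_mem measurableSet_Icc] with t ht
    exact indicator_of_mem (show t ∈ Ici (0 : ℝ) from ht.1) x
  refine Integrable.of_bound hmeas B ?_
  filter_upwards [ae_restrict_mem measurableSet_Icc] with t ht
  exact hB t ht

theorem LocallyBddOnNonneg.bddAbove_reflection {x : ℝ → ℝ} (hx : LocallyBddOnNonneg x) (t : ℝ) :
    BddAbove ((fun s => max (-x s) 0) '' Icc 0 t) := by
  obtain ⟨B, hB⟩ := hx t
  refine ⟨B, ?_⟩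
  rintro _ ⟨s, hs, rfl⟩
  exact max_le ((neg_le_abs _).trans (hB s hs)) ((abs_nonneg _).trans (hB s hs))

theorem psi_nonneg (x : ℝ → ℝ) (t : ℝ) : 0 ≤ psi x t := by
  refine Real.sSup_nonneg ?_
  rintro _ ⟨s, _, rfl⟩
  exact le_max_right _ _

theorem psi_monotoneOn {x : ℝ → ℝ} (hx : LocallyBddOnNonneg x) : MonotoneOn (psi x) (Ici 0) :=
  fun _ hs t _ hst => csSup_le_csSup (hx.bddAbove_reflection t)
    ((nonempty_Icc.2 hs).image _) (image_mono (Icc_subset_Icc_right hst))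

theorem psi_intervalIntegrable {x : ℝ → ℝ} (hx : LocallyBddOnNonneg x) {T : ℝ} (hT : 0 ≤ T) :
    IntervalIntegrable (psi x) volume 0 T := by
  refine MonotoneOn.intervalIntegrable ((psi_monotoneOn hx).mono ?_)
  rw [uIcc_of_le hT]
  exact fun t ht => ht.1

theorem psi_locallyBddOnNonneg {x : ℝ → ℝ} (hx : LocallyBddOnNonneg x) :
    LocallyBddOnNonneg (psi x) := fun T => ⟨psi x T, fun t ht => by
  rw [abs_of_nonneg (psi_nonneg x t)]
  exact psi_monotoneOn hx ht.1 (ht.1.trans ht.2) ht.2⟩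

theorem psi_le_psi_add {x y : ℝ → ℝ} (hy : LocallyBddOnNonneg y) {t B : ℝ} (ht : 0 ≤ t)
    (h : ∀ s ∈ Icc 0 t, |x s - y s| ≤ B) : psi x t ≤ psi y t + B := by
  refine csSup_le ((nonempty_Icc.2 ht).image _) ?_
  rintro _ ⟨s, hs, rfl⟩
  have hle : max (-y s) 0 ≤ psi y t := le_csSup (hy.bddAbove_reflection t) ⟨s, hs, rfl⟩
  have habs := abs_le.1 (h s hs)
  have h1 := le_max_left (-y s) 0
  have h2 := le_max_right (-y s) 0
  exact max_le (by linarith) (by linarith)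

/-- The one-sided reflection map is 1-Lipschitz for the uniform norm. -/
theorem abs_psi_sub_psi_le {x y : ℝ → ℝ} (hx : LocallyBddOnNonneg x) (hy : LocallyBddOnNonneg y)
    {t B : ℝ} (ht : 0 ≤ t) (h : ∀ s ∈ Icc 0 t, |x s - y s| ≤ B) :
    |psi x t - psi y t| ≤ B := by
  have h1 := psi_le_psi_add hy ht h
  have h2 := psi_le_psi_add hx ht fun s hs => abs_sub_comm (x s) (y s) ▸ h s hs
  exact abs_le.2 ⟨by linarith, by linarith⟩

theorem abs_le_supNorm {x : ℝ → ℝ} (hx : LocallyBddOnNonneg x) {t T : ℝ} (ht : t ∈ Icc 0 T) :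
    |x t| ≤ supNorm x T := by
  obtain ⟨B, hB⟩ := hx T
  refine le_csSup ⟨B, ?_⟩ ⟨t, ht, rfl⟩
  rintro _ ⟨s, hs, rfl⟩
  exact hB s hs

theorem supNorm_le {x : ℝ → ℝ} {T B : ℝ} (hT : 0 ≤ T) (h : ∀ t ∈ Icc 0 T, |x t| ≤ B) :
    supNorm x T ≤ B := by
  refine csSup_le ((nonempty_Icc.2 hT).image _) ?_
  rintro _ ⟨s, hs, rfl⟩
  exact h s hs

theorem continuousOn_primitive_Icc {x : ℝ → ℝ} {T : ℝ} (hT : 0 ≤ T)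
    (hx : IntervalIntegrable x volume 0 T) :
    ContinuousOn (fun t => ∫ s in (0 : ℝ)..t, x s) (Icc 0 T) := by
  have h := intervalIntegral.continuousOn_primitive_interval' hx left_mem_uIcc
  rwa [uIcc_of_le hT] at h

theorem locallyBddOnNonneg_primitive {x : ℝ → ℝ}
    (hx : ∀ T : ℝ, 0 ≤ T → IntervalIntegrable x volume 0 T) :
    LocallyBddOnNonneg (fun t => ∫ s in (0 : ℝ)..t, x s) := by
  intro T
  rcases le_or_gt 0 T with hT | hT
  · exact isCompact_Icc.exists_bound_of_continuousOn (continuousOn_primitive_Icc hT (hx T hT))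
  · exact ⟨0, fun t ht => absurd (ht.1.trans ht.2) (not_le.2 hT)⟩

theorem choose_add_le_succ_pow (m r : ℕ) : (m + r).choose m ≤ (r + 1) ^ m := by
  induction m with
  | zero => simp
  | succ m ih =>
    have h := Nat.add_one_mul_choose_eq (m + r) m
    have hle : (m + 1 + r).choose (m + 1) * (m + 1) ≤ (r + 1) ^ (m + 1) * (m + 1) := by
      calc (m + 1 + r).choose (m + 1) * (m + 1) = (m + r + 1) * (m + r).choose m := by
            rw [h]; congr 2; omega
        _ ≤ ((r + 1) * (m + 1)) * (r + 1) ^ m := Nat.mul_le_mul (by nlinarith) ih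
        _ = (r + 1) ^ (m + 1) * (m + 1) := by ring
    exact Nat.le_of_mul_le_mul_right hle m.succ_pos

theorem pow_le_factorial_mul_succ_pow (m r : ℕ) : m ^ r ≤ r.factorial * (r + 1) ^ m := by
  calc m ^ r ≤ (m + 1) ^ r := Nat.pow_le_pow_left m.le_succ r
    _ ≤ (m + 1).ascFactorial r := Nat.pow_succ_le_ascFactorial (m + 1) r
    _ = r.factorial * (m + r).choose r := Nat.ascFactorial_eq_factorial_mul_choose m r
    _ ≤ r.factorial * (r + 1) ^ m := by
      rw [← Nat.choose_symm_add]
      exact Nat.mul_le_mul_left _ (choose_add_le_succ_pow m r)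

theorem abs_integral_sub_le_of_pow_bound {x y : ℝ → ℝ} {c s : ℝ} {n : ℕ} (hs : 0 ≤ s)
    (hx : IntervalIntegrable x volume 0 s) (hy : IntervalIntegrable y volume 0 s)
    (h : ∀ r ∈ Icc 0 s, |x r - y r| ≤ c * (r ^ n / n.factorial)) :
    |(∫ r in (0 : ℝ)..s, x r) - ∫ r in (0 : ℝ)..s, y r| ≤
      c * (s ^ (n + 1) / (n + 1).factorial) := by
  rw [← intervalIntegral.integral_sub hx hy]
  have hle : ‖∫ r in (0 : ℝ)..s, (x r - y r)‖ ≤ ∫ r in (0 : ℝ)..s, c * (r ^ n / n.factorial) :=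
    intervalIntegral.norm_integral_le_of_norm_le hs
      (.of_forall fun r hr => h r (Ioc_subset_Icc_self hr))
      (Continuous.intervalIntegrable (by fun_prop) _ _)
  refine hle.trans_eq ?_
  rw [intervalIntegral.integral_const_mul, intervalIntegral.integral_div, integral_pow,
    Nat.factorial_succ]
  push_cast
  rw [div_div]
  simp

/-- Estimate (B.22): for `δ ∈ (0,T)` with `2δηJK < 1` (where `η = max_k η_k`),
`‖y_k^n − y_k^{n−1}‖_{mδ} ≤ m² nᵐ (2δηJK)^{n−1} C_{mδ}`, where
`C_t = max_k ‖ζ_k‖_t + Σ_j ‖ψ(ξ_j)‖_t`. -/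
theorem stmt7
    (J K : ℕ) (hJ : 0 < J) (hK : 0 < K)
    (μ : Fin J → ℝ) (hμ : ∀ j, 0 < μ j)
    (η : Fin K → ℝ) (hη : ∀ k, 0 < η k)
    (p : Fin J → Fin K → ℝ) (hp : ∀ j k, 0 ≤ p j k) (hprow : ∀ j, ∑ k, p j k = 1)
    (q : Fin K → Fin J → ℝ) (hq : ∀ k j, 0 ≤ q k j) (hqrow : ∀ k, ∑ j, q k j = 1)
    (ξ : Fin J → ℝ → ℝ) (hξ : ∀ j, Cadlag (ξ j))
    (ζ : Fin K → ℝ → ℝ) (hζ : ∀ k, Cadlag (ζ k))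
    (T δ : ℝ) (hT : 0 < T) (hδ : 0 < δ) (hδT : δ < T)
    (hsmall : 2 * δ * (⨆ k, η k) * J * K < 1)
    (yseq : ℕ → Fin K → ℝ → ℝ)
    (h0 : ∀ k, ∀ t : ℝ, yseq 0 k t = 0)
    (hrec : ∀ n : ℕ, ∀ k, ∀ t : ℝ,
      yseq (n + 1) k t =
        ζ k t - η k * (∫ s in (0:ℝ)..t, yseq n k s)
          - ∑ j, p j k *
              psi (fun r => ξ j r + ∑ l, q l j * η l * (∫ s in (0:ℝ)..r, yseq n l s)) t) :
    ∀ m n : ℕ, 1 ≤ m → 1 ≤ n → ∀ k,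
      supNorm (fun t => yseq n k t - yseq (n - 1) k t) (m * δ) ≤
        (m : ℝ) ^ 2 * (n : ℝ) ^ m * (2 * δ * (⨆ k', η k') * J * K) ^ (n - 1) *
          ((⨆ k', supNorm (ζ k') (m * δ)) + ∑ j, supNorm (psi (ξ j)) (m * δ)) := by
  have hprim : ∀ n, (∀ k, ∀ t : ℝ, 0 ≤ t → IntervalIntegrable (yseq n k) volume 0 t) →
      ∀ j, LocallyBddOnNonneg
        (fun r => ξ j r + ∑ l, q l j * η l * (∫ s in (0:ℝ)..r, yseq n l s)) := fun n hn j =>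
    (hξ j).locallyBddOnNonneg.add (LocallyBddOnNonneg.sum _ fun l =>
      (locallyBddOnNonneg_primitive (hn l)).const_mul (q l j * η l))
  have hint : ∀ n k, ∀ t : ℝ, 0 ≤ t → IntervalIntegrable (yseq n k) volume 0 t := by
    intro n
    induction n with
    | zero =>
      intro k t _
      rw [show yseq 0 k = fun _ => 0 from funext (h0 k)]
      exact intervalIntegrable_const
    | succ n ih =>
      intro k t ht
      rw [show yseq (n + 1) k = _ from funext (hrec n k)]
      have hcont : IntervalIntegrable (fun t => ∫ s in (0:ℝ)..t, yseq n k s) volume 0 t := by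
        refine ContinuousOn.intervalIntegrable ?_
        rw [uIcc_of_le ht]
        exact continuousOn_primitive_Icc ht (ih k t ht)
      refine (((hζ k).intervalIntegrable ht).sub (hcont.const_mul _)).sub ?_
      have hsum := IntervalIntegrable.sum (μ := volume) (a := 0) (b := t) Finset.univ
        fun j (_ : j ∈ Finset.univ) =>
          (psi_intervalIntegrable (hprim n ih j) ht).const_mul (p j k)
      rwa [Finset.sum_fn] at hsum
  have hbdd := fun n => hprim n (hint n)
  set E := ⨆ k, η k with hE
  have hηE : ∀ k, η k ≤ E := fun k => le_ciSup (finite_range η).bddAbove k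
  have hE0 : 0 ≤ E := (hη ⟨0, hK⟩).le.trans (hηE _)
  have hJ1 : (1 : ℝ) ≤ J := by exact_mod_cast hJ
  have hK1 : (1 : ℝ) ≤ K := by exact_mod_cast hK
  have hp1 : ∀ j k, p j k ≤ 1 := fun j k =>
    hprow j ▸ Finset.single_le_sum (fun i _ => hp j i) (Finset.mem_univ k)
  have hq1 : ∀ l j, q l j ≤ 1 := fun l j =>
    hqrow l ▸ Finset.single_le_sum (fun i _ => hq l i) (Finset.mem_univ j)
  intro m n hm hn k
  obtain ⟨n, rfl⟩ := Nat.exists_eq_add_of_le' hn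
  rw [Nat.add_sub_cancel]
  set M : ℝ := m * δ with hM
  have hM0 : 0 ≤ M := by positivity
  set C := (⨆ k', supNorm (ζ k') M) + ∑ j, supNorm (psi (ξ j)) M with hC
  set a := 2 * E * J * K with ha
  have ha0 : 0 ≤ a := by positivity
  have hbase : ∀ k, ∀ t ∈ Icc 0 M, |yseq 1 k t - yseq 0 k t| ≤ C := by
    intro k t ht
    have hy : yseq 1 k t - yseq 0 k t = ζ k t - ∑ j, p j k * psi (ξ j) t := by
      rw [hrec 0 k t]
      simp [h0]
    rw [hy]
    refine (abs_sub _ _).trans (add_le_add ?_ ?_)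
    · exact (abs_le_supNorm (hζ k).locallyBddOnNonneg ht).trans
        (le_ciSup (f := fun k' => supNorm (ζ k') M) (finite_range _).bddAbove k)
    · refine (Finset.abs_sum_le_sum_abs _ _).trans (Finset.sum_le_sum fun j _ => ?_)
      rw [abs_mul, abs_of_nonneg (hp j k)]
      exact (mul_le_of_le_one_left (abs_nonneg _) (hp1 j k)).trans
        (abs_le_supNorm (psi_locallyBddOnNonneg (hξ j).locallyBddOnNonneg) ht)
  have hC0 : 0 ≤ C := (abs_nonneg _).trans (hbase k 0 ⟨le_rfl, hM0⟩)
  have hmain : ∀ n k, ∀ t ∈ Icc 0 M,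
      |yseq (n + 1) k t - yseq n k t| ≤ C * a ^ n * (t ^ n / n.factorial) := by
    intro n
    induction n with
    | zero => simpa using hbase
    | succ n ih =>
      intro k t ht
      set I : ℝ := C * a ^ n * (t ^ (n + 1) / (n + 1).factorial) with hI
      have hI0 : 0 ≤ I := mul_nonneg (by positivity) (div_nonneg (pow_nonneg ht.1 _) (by positivity))
      have hdiff : ∀ l, ∀ s ∈ Icc 0 t,
          |(∫ r in (0:ℝ)..s, yseq (n + 1) l r) - ∫ r in (0:ℝ)..s, yseq n l r| ≤ I := by
        intro l s hs
        refine (abs_integral_sub_le_of_pow_bound hs.1 (hint _ l s hs.1) (hint _ l s hs.1)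
          fun r hr => ih l r ⟨hr.1, hr.2.trans (hs.2.trans ht.2)⟩).trans ?_
        have := pow_le_pow_left₀ hs.1 hs.2 (n + 1)
        rw [hI]
        gcongr
      have hpsi : ∀ j, |psi (fun r => ξ j r + ∑ l, q l j * η l *
            (∫ s in (0:ℝ)..r, yseq (n + 1) l s)) t -
          psi (fun r => ξ j r + ∑ l, q l j * η l * (∫ s in (0:ℝ)..r, yseq n l s)) t| ≤
            ∑ l, q l j * (E * I) := by
        intro j
        refine abs_psi_sub_psi_le (hbdd _ j) (hbdd _ j) ht.1 fun s hs => ?_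
        rw [add_sub_add_left_eq_sub, ← Finset.sum_sub_distrib]
        refine (Finset.abs_sum_le_sum_abs _ _).trans (Finset.sum_le_sum fun l _ => ?_)
        rw [← mul_sub, abs_mul, abs_of_nonneg (mul_nonneg (hq l j) (hη l).le), mul_assoc]
        exact mul_le_mul_of_nonneg_left
          (mul_le_mul (hηE l) (hdiff l s hs) (abs_nonneg _) hE0) (hq l j)
      have hsum : |∑ j, p j k * psi (fun r => ξ j r + ∑ l, q l j * η l *
            (∫ s in (0:ℝ)..r, yseq (n + 1) l s)) t -
          ∑ j, p j k * psi (fun r => ξ j r + ∑ l, q l j * η l *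
            (∫ s in (0:ℝ)..r, yseq n l s)) t| ≤ J * K * (E * I) := by
        rw [← Finset.sum_sub_distrib]
        refine (Finset.abs_sum_le_sum_abs _ _).trans ((Finset.sum_le_sum
          (g := fun _ => (K : ℝ) * (E * I)) fun j _ => ?_).trans_eq ?_)
        · rw [← mul_sub, abs_mul, abs_of_nonneg (hp j k)]
          refine (mul_le_of_le_one_left (abs_nonneg _) (hp1 j k)).trans ((hpsi j).trans ?_)
          refine (Finset.sum_le_sum fun l _ =>
            mul_le_of_le_one_left (mul_nonneg hE0 hI0) (hq1 l j)).trans_eq ?_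
          simp
        · simp [mul_assoc]
      have hlin : |η k * ((∫ s in (0:ℝ)..t, yseq (n + 1) k s) - ∫ s in (0:ℝ)..t, yseq n k s)| ≤
          J * K * (E * I) := by
        rw [abs_mul, abs_of_nonneg (hη k).le]
        refine (mul_le_mul (hηE k) (hdiff k t ⟨ht.1, le_rfl⟩) (abs_nonneg _) hE0).trans ?_
        exact le_mul_of_one_le_left (mul_nonneg hE0 hI0) (one_le_mul_of_one_le_of_one_le hJ1 hK1)
      rw [hrec (n + 1) k t, hrec n k t]
      have hgoal : C * a ^ (n + 1) * (t ^ (n + 1) / (n + 1).factorial) =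
          J * K * (E * I) + J * K * (E * I) := by
        rw [hI, ha]
        ring
      rw [hgoal]
      have h1 := abs_le.1 hlin
      have h2 := abs_le.1 hsum
      exact abs_le.2 ⟨by linarith, by linarith⟩
  refine supNorm_le hM0 fun t ht => (hmain n k t ht).trans ?_
  have hcomb : (m : ℝ) ^ n / n.factorial ≤ (m : ℝ) ^ 2 * ((n : ℝ) + 1) ^ m := by
    rw [div_le_iff₀ (by positivity)]
    have h1 : (m : ℝ) ^ n ≤ n.factorial * ((n : ℝ) + 1) ^ m := by
      exact_mod_cast pow_le_factorial_mul_succ_pow m n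
    have h2 : (1 : ℝ) ≤ (m : ℝ) ^ 2 := one_le_pow₀ (by exact_mod_cast hm)
    calc (m : ℝ) ^ n ≤ n.factorial * ((n : ℝ) + 1) ^ m := h1
      _ ≤ (m : ℝ) ^ 2 * (n.factorial * ((n : ℝ) + 1) ^ m) :=
        le_mul_of_one_le_left (by positivity) h2
      _ = _ := by ring
  have htM := pow_le_pow_left₀ ht.1 ht.2 n
  calc C * a ^ n * (t ^ n / n.factorial) ≤ C * a ^ n * (M ^ n / n.factorial) := by gcongr
    _ = (m : ℝ) ^ n / n.factorial * ((2 * δ * E * J * K) ^ n * C) := by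
      rw [hM, ha, show 2 * δ * E * J * K = δ * (2 * E * J * K) by ring, mul_pow, mul_pow δ]
      ring
    _ ≤ (m : ℝ) ^ 2 * ((n : ℝ) + 1) ^ m * ((2 * δ * E * J * K) ^ n * C) := by gcongr
    _ = _ := by push_cast; ring
end
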